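/- arXiv:2510.17091 — 2 statements merged into one kernel-verified Lean document; each statement's English description precedes it below -/
import Mathlib

section
/- Fix an integer n ≥ 2. For all real numbers 0 < a < b < ∞, the first Dirichlet eigenvalue of the annulus A_{a,b} ⊆ ℝⁿ satisfies C₁(n, b/a)/(b−a)² ≤ λ(A_{a,b}) ≤ C₂(n, b/a)/(b−a)², where, writing x = b/a: for n ≥ 3, C₁(n,x) = max{ (nπ²/4)(1 − 1/x)², π² + ((n−1)(n−3)/4)(1 − 1/x)² } and C₂(n,x) = min{ n²π², π² + ((n−1)(n−3)/4)(x−1)² }; for n = 2, C₁(2,x) = max{ (π²/2)(1 − 1/x)², π² − (1/4)(x−1)² } and C₂(2,x) = min{ 4π², π² − (1/4)(1 − 1/x)² }. -/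
open Real MeasureTheory

noncomputable def dirichletEigenvalue (n : ℕ) (U : Set (EuclideanSpace ℝ (Fin n))) : ℝ :=
  sInf {R : ℝ | ∃ f : EuclideanSpace ℝ (Fin n) → ℝ,
    ContDiff ℝ (⊤ : ℕ∞) f ∧ HasCompactSupport f ∧ tsupport f ⊆ U ∧ f ≠ 0 ∧
    R = (∫ x, ‖fderiv ℝ f x‖ ^ 2) / (∫ x, (f x) ^ 2)}

def annulus (n : ℕ) (a b : ℝ) : Set (EuclideanSpace ℝ (Fin n)) :=
  {x | a < ‖x‖ ∧ ‖x‖ < b}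

/-- The lower-bound constant $C_1(n,x)$. -/
noncomputable def Cone (n : ℕ) (x : ℝ) : ℝ :=
  if 3 ≤ n then
    max (((n : ℝ) * π ^ 2 / 4) * (1 - 1 / x) ^ 2)
        (π ^ 2 + (((n : ℝ) - 1) * ((n : ℝ) - 3) / 4) * (1 - 1 / x) ^ 2)
  else
    max ((π ^ 2 / 2) * (1 - 1 / x) ^ 2) (π ^ 2 - (1 / 4) * (x - 1) ^ 2)

/-- The upper-bound constant $C_2(n,x)$. -/
noncomputable def Ctwo (n : ℕ) (x : ℝ) : ℝ :=
  if 3 ≤ n then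
    min ((n : ℝ) ^ 2 * π ^ 2) (π ^ 2 + (((n : ℝ) - 1) * ((n : ℝ) - 3) / 4) * (x - 1) ^ 2)
  else
    min (4 * π ^ 2) (π ^ 2 - (1 / 4) * (1 - 1 / x) ^ 2)

/-- The divergence of a vector field on Euclidean space. -/
noncomputable def divergence {n : ℕ} (V : EuclideanSpace ℝ (Fin n) → EuclideanSpace ℝ (Fin n))
    (x : EuclideanSpace ℝ (Fin n)) : ℝ :=
  ∑ i, fderiv ℝ (fun y => V y i) x (EuclideanSpace.single i 1)

section IntegrationByParts

variable {n : ℕ} {U : Set (EuclideanSpace ℝ (Fin n))}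
  {V : EuclideanSpace ℝ (Fin n) → EuclideanSpace ℝ (Fin n)}

lemma integrable_mul_of_continuousOn (hU : IsOpen U) {u g : EuclideanSpace ℝ (Fin n) → ℝ}
    (hu : Continuous u) (hc : HasCompactSupport u) (hs : tsupport u ⊆ U)
    (hg : ContinuousOn g U) : Integrable (fun x => u x * g x) := by
  refine Continuous.integrable_of_hasCompactSupport ?_ hc.mul_right
  refine continuous_of_tsupport fun x hx => ?_
  have hxU : x ∈ U := hs (tsupport_mul_subset_left hx)
  exact hu.continuousAt.mul (hg.continuousAt (hU.mem_nhds hxU))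

lemma ContDiffOn.apply_euclidean {k : WithTop ℕ∞} (hV : ContDiffOn ℝ k V U) (i : Fin n) :
    ContDiffOn ℝ k (fun y => V y i) U :=
  (EuclideanSpace.proj (𝕜 := ℝ) i).contDiff.comp_contDiffOn hV

lemma ContDiffOn.continuousOn_divergence (hU : IsOpen U) (hV : ContDiffOn ℝ 1 V U) :
    ContinuousOn (divergence V) U :=
  continuousOn_finsetSum _ fun i _ =>
    ((hV.apply_euclidean i).continuousOn_fderiv_of_isOpen hU le_rfl).clm_apply continuousOn_const

lemma integral_mul_divergence (hU : IsOpen U) (hV : ContDiffOn ℝ 1 V U)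
    {w : EuclideanSpace ℝ (Fin n) → ℝ} (hw : ContDiff ℝ 1 w) (hc : HasCompactSupport w)
    (hs : tsupport w ⊆ U) :
    ∫ x, w x * divergence V x = - ∫ x, fderiv ℝ w x (V x) := by
  have hcV : ∀ i, ContinuousOn (fun y => V y i) U := fun i => (hV.apply_euclidean i).continuousOn
  have hcD : ∀ i, ContinuousOn
      (fun x => fderiv ℝ (fun y => V y i) x (EuclideanSpace.single i 1)) U := fun i =>
    ((hV.apply_euclidean i).continuousOn_fderiv_of_isOpen hU le_rfl).clm_apply continuousOn_const
  have h1 : ∀ i, Integrable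
      (fun x => w x * fderiv ℝ (fun y => V y i) x (EuclideanSpace.single i 1)) := fun i =>
    integrable_mul_of_continuousOn hU hw.continuous hc hs (hcD i)
  have h2 : ∀ i, Integrable
      (fun x => fderiv ℝ w x (EuclideanSpace.single i 1) * V x i) := fun i =>
    integrable_mul_of_continuousOn hU
      ((hw.continuous_fderiv one_ne_zero).clm_apply continuous_const)
      (hc.fderiv_apply ℝ _) ((tsupport_fderiv_apply_subset ℝ _).trans hs) (hcV i)
  have h3 : ∀ i, Integrable (fun x => w x * V x i) := fun i =>
    integrable_mul_of_continuousOn hU hw.continuous hc hs (hcV i)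
  have key : ∀ i, ∫ x, w x * fderiv ℝ (fun y => V y i) x (EuclideanSpace.single i 1)
      = - ∫ x, fderiv ℝ w x (EuclideanSpace.single i 1) * V x i := fun i =>
    integral_mul_fderiv_eq_neg_fderiv_mul_of_integrable (h2 i) (h1 i) (h3 i)
      (fun x _ => hw.differentiable one_ne_zero x)
      (fun x hx => ((hV.apply_euclidean i).contDiffAt (hU.mem_nhds (hs hx))).differentiableAt
        one_ne_zero)
  have hV' : ∀ x, fderiv ℝ w x (V x)
      = ∑ i, fderiv ℝ w x (EuclideanSpace.single i 1) * V x i := by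
    intro x
    conv_lhs => rw [← (EuclideanSpace.basisFun (Fin n) ℝ).sum_repr (V x)]
    simp [map_sum, mul_comm]
  simp only [divergence, Finset.mul_sum, hV']
  rw [integral_finsetSum _ fun i _ => h1 i, integral_finsetSum _ fun i _ => h2 i,
    ← Finset.sum_neg_distrib]
  exact Finset.sum_congr rfl fun i _ => key i

/-- The Barta inequality: if `div V + |V|² ≤ -μ` on `U`, then `μ` bounds the Rayleigh quotient of
every test function supported in `U` from below. -/
lemma mul_integral_sq_le_of_divergence_add_sq_le (hU : IsOpen U) (hV : ContDiffOn ℝ 1 V U) {μ : ℝ}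
    (hμ : ∀ x ∈ U, divergence V x + ‖V x‖ ^ 2 ≤ -μ)
    {f : EuclideanSpace ℝ (Fin n) → ℝ} (hf : ContDiff ℝ 1 f) (hc : HasCompactSupport f)
    (hs : tsupport f ⊆ U) :
    μ * ∫ x, f x ^ 2 ≤ ∫ x, ‖fderiv ℝ f x‖ ^ 2 := by
  have hw : ContDiff ℝ 1 fun x => f x ^ 2 := hf.pow 2
  have hcw : HasCompactSupport fun x => f x ^ 2 := by
    simp only [sq]
    exact hc.mul_right
  have hsw : tsupport (fun x => f x ^ 2) ⊆ U := by
    refine Set.Subset.trans ?_ hs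
    simp only [sq]
    exact tsupport_mul_subset_left
  have hdf := hf.continuous_fderiv one_ne_zero
  have ibp := integral_mul_divergence hU hV hw hcw hsw
  have i1 : Integrable fun x => f x ^ 2 * divergence V x :=
    integrable_mul_of_continuousOn hU hw.continuous hcw hsw (hV.continuousOn_divergence hU)
  have i2 : Integrable fun x => f x ^ 2 * ‖V x‖ ^ 2 :=
    integrable_mul_of_continuousOn hU hw.continuous hcw hsw (hV.continuousOn.norm.pow 2)
  have hfd : ∀ x, fderiv ℝ (fun x => f x ^ 2) x (V x) = 2 * (f x * fderiv ℝ f x (V x)) := by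
    intro x
    have := ((hf.differentiable one_ne_zero x).hasFDerivAt.pow 2).fderiv
    rw [this]
    simp
    ring
  have i3 : Integrable fun x => fderiv ℝ (fun x => f x ^ 2) x (V x) := by
    simp only [hfd]
    refine (integrable_mul_of_continuousOn hU hf.continuous hc hs ?_).const_mul 2
    exact hdf.continuousOn.clm_apply hV.continuousOn
  have i4 : Integrable fun x => ‖fderiv ℝ f x‖ ^ 2 := by
    refine (hdf.norm.pow 2).integrable_of_hasCompactSupport ?_
    have := (hc.fderiv ℝ).norm
    simp only [sq]
    exact this.mul_right
  have i5 : Integrable fun x => f x ^ 2 := hw.continuous.integrable_of_hasCompactSupport hcw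
  have hpt : ∀ x, μ * f x ^ 2 ≤ - (f x ^ 2 * divergence V x + f x ^ 2 * ‖V x‖ ^ 2) := by
    intro x
    by_cases hx : x ∈ U
    · nlinarith [hμ x hx, sq_nonneg (f x)]
    · have : f x = 0 := image_eq_zero_of_notMem_tsupport fun h => hx (hs h)
      simp [this]
  have hpt2 : ∀ x, fderiv ℝ (fun x => f x ^ 2) x (V x) - f x ^ 2 * ‖V x‖ ^ 2
      ≤ ‖fderiv ℝ f x‖ ^ 2 := by
    intro x
    rw [hfd]
    have h1 := (fderiv ℝ f x).le_opNorm (V x)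
    have h2 : f x * fderiv ℝ f x (V x) ≤ |f x| * (‖fderiv ℝ f x‖ * ‖V x‖) := by
      refine (le_abs_self _).trans ?_
      rw [abs_mul]
      exact mul_le_mul_of_nonneg_left h1 (abs_nonneg _)
    nlinarith [sq_nonneg (‖fderiv ℝ f x‖ - |f x| * ‖V x‖), sq_abs (f x)]
  calc μ * ∫ x, f x ^ 2 = ∫ x, μ * f x ^ 2 := (integral_const_mul _ _).symm
    _ ≤ ∫ x, - (f x ^ 2 * divergence V x + f x ^ 2 * ‖V x‖ ^ 2) :=
        integral_mono (i5.const_mul μ) (i1.add i2).neg hpt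
    _ = ∫ x, (fderiv ℝ (fun x => f x ^ 2) x (V x) - f x ^ 2 * ‖V x‖ ^ 2) := by
        rw [integral_neg, integral_add i1 i2, integral_sub i3 i2, ibp]
        ring
    _ ≤ _ := integral_mono (i3.sub i2) i4 hpt2

end IntegrationByParts
section TestFunctions

/-- A smooth truncation `h` of the identity, vanishing below `ε` and at distance at most `2 * ε`
from the identity, together with a primitive `H` of `h' ^ 2`. -/
lemma exists_smooth_truncation {ε : ℝ} (hε : 0 < ε) :
    ∃ h h' H : ℝ → ℝ, ContDiff ℝ (⊤ : ℕ∞) h ∧ ContDiff ℝ 1 H ∧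
      (∀ t, HasDerivAt h (h' t) t) ∧ (∀ t, HasDerivAt H (h' t ^ 2) t) ∧
      (∀ t ≤ ε, h t = 0 ∧ H t = 0) ∧
      (∀ t, 0 ≤ t → 0 ≤ h t ∧ t - 2 * ε ≤ h t ∧ 0 ≤ H t ∧ H t ≤ t) := by
  set s : ℝ → ℝ := fun t => Real.smoothTransition (t / ε - 1)
  have hsm : ContDiff ℝ (⊤ : ℕ∞) s := by
    refine Real.smoothTransition.contDiff.comp ?_
    fun_prop
  have hsc : Continuous s := hsm.continuous
  have hsc2 : Continuous fun t => s t ^ 2 := hsc.pow 2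
  have hs0 : ∀ t, 0 ≤ s t := fun t => Real.smoothTransition.nonneg _
  have hs1 : ∀ t, s t ≤ 1 := fun t => Real.smoothTransition.le_one _
  have hs2 : ∀ t, s t ^ 2 ≤ 1 := fun t => pow_le_one₀ (hs0 t) (hs1 t)
  have hsz : ∀ t ≤ ε, s t = 0 := fun t ht => by
    refine Real.smoothTransition.zero_of_nonpos ?_
    have : t / ε ≤ 1 := (div_le_one hε).2 ht
    linarith
  have hso : ∀ t, 2 * ε ≤ t → s t = 1 := fun t ht => by
    refine Real.smoothTransition.one_of_one_le ?_
    have : 2 ≤ t / ε := (le_div_iff₀ hε).2 ht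
    linarith
  have hd : ∀ t, HasDerivAt (fun t => ∫ u in ε..t, s u) (s t) t := fun t =>
    intervalIntegral.integral_hasDerivAt_right (hsc.intervalIntegrable _ _)
      (hsc.stronglyMeasurableAtFilter _ _) hsc.continuousAt
  have hd2 : ∀ t, HasDerivAt (fun t => ∫ u in ε..t, s u ^ 2) (s t ^ 2) t := fun t =>
    intervalIntegral.integral_hasDerivAt_right (hsc2.intervalIntegrable _ _)
      (hsc2.stronglyMeasurableAtFilter _ _) hsc2.continuousAt
  have hz : ∀ t ≤ ε, (∫ u in ε..t, s u) = 0 ∧ (∫ u in ε..t, s u ^ 2) = 0 := by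
    intro t ht
    have : ∀ u ∈ Set.uIcc ε t, s u = 0 := fun u hu => by
      rw [Set.uIcc_of_ge ht] at hu
      exact hsz u hu.2
    constructor
    · rw [intervalIntegral.integral_congr (g := fun _ => (0 : ℝ)) (fun u hu => this u hu)]
      simp
    · rw [intervalIntegral.integral_congr (g := fun _ => (0 : ℝ))
        (fun u hu => by simp [this u hu])]
      simp
  refine ⟨fun t => ∫ u in ε..t, s u, s, fun t => ∫ u in ε..t, s u ^ 2, ?_, ?_, hd, hd2, hz, ?_⟩
  · rw [contDiff_infty_iff_deriv]
    refine ⟨fun t => (hd t).differentiableAt, ?_⟩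
    rwa [show deriv (fun t => ∫ u in ε..t, s u) = s from funext fun t => (hd t).deriv]
  · rw [contDiff_one_iff_deriv]
    refine ⟨fun t => (hd2 t).differentiableAt, ?_⟩
    rwa [show deriv (fun t => ∫ u in ε..t, s u ^ 2) = fun t => s t ^ 2 from
      funext fun t => (hd2 t).deriv]
  · intro t ht
    simp only
    rcases le_total t ε with hle | hle
    · rw [(hz t hle).1, (hz t hle).2]
      exact ⟨le_rfl, by linarith, le_rfl, ht⟩
    · have hpos : 0 ≤ ∫ u in ε..t, s u :=
        intervalIntegral.integral_nonneg hle fun u _ => hs0 u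
      refine ⟨hpos, ?_, intervalIntegral.integral_nonneg hle fun u _ => sq_nonneg _, ?_⟩
      · rcases le_total t (2 * ε) with h2 | h2
        · linarith
        · rw [← intervalIntegral.integral_add_adjacent_intervals
            (hsc.intervalIntegrable ε (2 * ε)) (hsc.intervalIntegrable (2 * ε) t)]
          have e1 : 0 ≤ ∫ u in ε..(2 * ε), s u :=
            intervalIntegral.integral_nonneg (by linarith) fun u _ => hs0 u
          have e2 : ∫ u in (2 * ε)..t, s u = t - 2 * ε := by
            rw [intervalIntegral.integral_congr (g := fun _ => (1 : ℝ))]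
            · simp
            · intro u hu
              rw [Set.uIcc_of_le h2] at hu
              exact hso u hu.1
          linarith
      · have : ∫ u in ε..t, s u ^ 2 ≤ ∫ _ in ε..t, (1 : ℝ) :=
          intervalIntegral.integral_mono_on hle (hsc2.intervalIntegrable _ _)
            intervalIntegrable_const fun u _ => hs2 u
        simp at this
        linarith

lemma contDiff_of_contDiffAt_tsupport {E : Type*} [NormedAddCommGroup E] [NormedSpace ℝ E]
    {k : WithTop ℕ∞} {f : E → ℝ} (hf : ∀ x ∈ tsupport f, ContDiffAt ℝ k f x) :
    ContDiff ℝ k f := by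
  refine contDiff_iff_contDiffAt.2 fun x => ?_
  by_cases hx : x ∈ tsupport f
  · exact hf x hx
  · exact contDiffAt_const.congr_of_eventuallyEq (notMem_tsupport_iff_eventuallyEq.1 hx)

variable {n : ℕ} {U Ω : Set (EuclideanSpace ℝ (Fin n))}
  {V : EuclideanSpace ℝ (Fin n) → EuclideanSpace ℝ (Fin n)}

lemma bddBelow_rayleigh (Ω : Set (EuclideanSpace ℝ (Fin n))) :
    BddBelow {R : ℝ | ∃ f : EuclideanSpace ℝ (Fin n) → ℝ,
    ContDiff ℝ (⊤ : ℕ∞) f ∧ HasCompactSupport f ∧ tsupport f ⊆ Ω ∧ f ≠ 0 ∧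
    R = (∫ x, ‖fderiv ℝ f x‖ ^ 2) / (∫ x, (f x) ^ 2)} := by
  refine ⟨0, ?_⟩
  rintro R ⟨f, -, -, -, -, rfl⟩
  exact div_nonneg (integral_nonneg fun x => by positivity) (integral_nonneg fun x => by positivity)

lemma integral_sq_pos {f : EuclideanSpace ℝ (Fin n) → ℝ} (hf : Continuous f)
    (hc : HasCompactSupport f) (h0 : f ≠ 0) : 0 < ∫ x, f x ^ 2 := by
  obtain ⟨x, hx⟩ := Function.ne_iff.1 h0
  refine (hf.pow 2).integral_pos_of_hasCompactSupport_nonneg_nonzero ?_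
    (fun x => sq_nonneg _) (x := x) (pow_ne_zero 2 hx)
  simp only [sq]
  exact hc.mul_right

lemma dirichletEigenvalue_nonneg (Ω : Set (EuclideanSpace ℝ (Fin n))) :
    0 ≤ dirichletEigenvalue n Ω := by
  refine Real.sInf_nonneg ?_
  rintro R ⟨f, -, -, -, -, rfl⟩
  exact div_nonneg (integral_nonneg fun x => by positivity) (integral_nonneg fun x => by positivity)

lemma dirichletEigenvalue_mul_le {f : EuclideanSpace ℝ (Fin n) → ℝ}
    (hf : ContDiff ℝ (⊤ : ℕ∞) f) (hc : HasCompactSupport f) (hs : tsupport f ⊆ Ω) :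
    dirichletEigenvalue n Ω * ∫ x, f x ^ 2 ≤ ∫ x, ‖fderiv ℝ f x‖ ^ 2 := by
  by_cases h0 : f = 0
  · simp [h0]
  · rw [← le_div_iff₀ (integral_sq_pos hf.continuous hc h0)]
    exact csInf_le (bddBelow_rayleigh Ω) ⟨f, hf, hc, hs, h0, rfl⟩

lemma le_dirichletEigenvalue (hU : IsOpen U) (hV : ContDiffOn ℝ 1 V U) {μ : ℝ}
    (hμ : ∀ x ∈ U, divergence V x + ‖V x‖ ^ 2 ≤ -μ)
    (hΩ : IsOpen Ω) (hne : Ω.Nonempty) (hΩU : Ω ⊆ U) :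
    μ ≤ dirichletEigenvalue n Ω := by
  refine le_csInf ?_ ?_
  · obtain ⟨x, hx⟩ := hne
    obtain ⟨f, hs, hc, hf, -, hfx⟩ :=
      exists_contDiff_tsupport_subset (n := (⊤ : ℕ∞)) (hΩ.mem_nhds hx)
    refine ⟨_, f, hf, hc, hs, ?_, rfl⟩
    rintro rfl
    simp at hfx
  · rintro R ⟨f, hf, hc, hs, h0, rfl⟩
    rw [le_div_iff₀ (integral_sq_pos hf.continuous hc h0)]
    exact mul_integral_sq_le_of_divergence_add_sq_le hU hV hμ
      (hf.of_le (by exact_mod_cast le_top)) hc (hs.trans hΩU)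

/-- A continuous function `φ` vanishing off a bounded open set `U ⊆ Ω`, with logarithmic gradient
`V` on `U` such that `div V + |V|² ≥ -μ`, bounds the first Dirichlet eigenvalue by `μ`. -/
lemma dirichletEigenvalue_le (hU : IsOpen U) (hb : Bornology.IsBounded U) (hne : U.Nonempty)
    (hUΩ : U ⊆ Ω) (hV : ContDiffOn ℝ 1 V U) {μ : ℝ} (hμ0 : 0 ≤ μ)
    (hμ : ∀ x ∈ U, -μ ≤ divergence V x + ‖V x‖ ^ 2)
    {φ : EuclideanSpace ℝ (Fin n) → ℝ} (hφ : Continuous φ) (hφ0 : ∀ x ∉ U, φ x = 0)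
    (hφpos : ∀ x ∈ U, 0 < φ x) (hφU : ContDiffOn ℝ (⊤ : ℕ∞) φ U)
    (hφV : ∀ x ∈ U, HasFDerivAt φ (φ x • innerSL ℝ (V x)) x) :
    dirichletEigenvalue n Ω ≤ μ := by
  have hnn : ∀ x, 0 ≤ φ x := fun x => by
    by_cases hx : x ∈ U
    · exact (hφpos x hx).le
    · exact (hφ0 x hx).ge
  have hφc : HasCompactSupport φ :=
    HasCompactSupport.intro hb.isCompact_closure fun x hx => hφ0 x fun h => hx (subset_closure h)
  have hφc2 : HasCompactSupport fun x => φ x ^ 2 := by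
    simp only [sq]
    exact hφc.mul_right
  have iφ : Integrable φ := hφ.integrable_of_hasCompactSupport hφc
  have iφ2 : Integrable fun x => φ x ^ 2 := (hφ.pow 2).integrable_of_hasCompactSupport hφc2
  have hI : 0 < ∫ x, φ x ^ 2 := by
    obtain ⟨x, hx⟩ := hne
    exact integral_sq_pos hφ hφc fun h => (hφpos x hx).ne' (by simp [h])
  have hJ : 0 ≤ ∫ x, φ x := integral_nonneg hnn
  have hlam := dirichletEigenvalue_nonneg Ω
  set lam := dirichletEigenvalue n Ω with hlam_def
  have main : ∀ ε > 0, lam * ((∫ x, φ x ^ 2) - 4 * ε * ∫ x, φ x) ≤ μ * ∫ x, φ x ^ 2 := by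
    intro ε hε
    obtain ⟨h, h', H, hh, hH, hdh, hdH, hz, hbd⟩ := exists_smooth_truncation hε
    have hsupp : ∀ g : ℝ → ℝ, (∀ t ≤ ε, g t = 0) →
        tsupport (fun x => g (φ x)) ⊆ U := by
      intro g hg
      have h1 : tsupport (fun x => g (φ x)) ⊆ {x | ε ≤ φ x} := by
        refine closure_minimal (fun x hx => ?_) (isClosed_le continuous_const hφ)
        by_contra hlt
        exact hx (hg _ (not_le.1 hlt).le)
      refine h1.trans fun x hx => ?_
      by_contra hxU
      have : ε ≤ φ x := hx
      rw [hφ0 x hxU] at this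
      linarith
    have hcomp : ∀ g : ℝ → ℝ, (∀ t ≤ ε, g t = 0) → HasCompactSupport fun x => g (φ x) :=
      fun g hg => HasCompactSupport.intro hφc.isCompact fun x hx => by
        rw [image_eq_zero_of_notMem_tsupport hx]
        exact hg 0 hε.le
    have hzw : ∀ t ≤ ε, H t * t = 0 := fun t ht => by simp [(hz t ht).2]
    have hsf := hsupp h fun t ht => (hz t ht).1
    have hcf := hcomp h fun t ht => (hz t ht).1
    have hsw := hsupp (fun t => H t * t) hzw
    have hcw := hcomp (fun t => H t * t) hzw
    have hf : ContDiff ℝ (⊤ : ℕ∞) fun x => h (φ x) := by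
      refine contDiff_of_contDiffAt_tsupport fun x hx => ?_
      exact hh.contDiffAt.comp x (hφU.contDiffAt (hU.mem_nhds (hsf hx)))
    have hw : ContDiff ℝ 1 fun x => H (φ x) * φ x := by
      refine contDiff_of_contDiffAt_tsupport fun x hx => ?_
      have := (hφU.contDiffAt (hU.mem_nhds (hsw hx))).of_le
        (show (1 : WithTop ℕ∞) ≤ ((⊤ : ℕ∞) : WithTop ℕ∞) by exact_mod_cast le_top)
      exact (hH.contDiffAt.comp x this).mul this
    have hfd : ∀ x ∈ U, ‖fderiv ℝ (fun x => h (φ x)) x‖ ^ 2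
        = h' (φ x) ^ 2 * φ x ^ 2 * ‖V x‖ ^ 2 := by
      intro x hx
      have := ((hdh (φ x)).comp_hasFDerivAt x (hφV x hx)).fderiv
      rw [show (fun x => h (φ x)) = h ∘ φ from rfl, this, norm_smul, norm_smul, innerSL_apply_norm,
        mul_pow, mul_pow, Real.norm_eq_abs, Real.norm_eq_abs, sq_abs, sq_abs]
      ring
    have hwd : ∀ x ∈ U, fderiv ℝ (fun x => H (φ x) * φ x) x (V x)
        = (h' (φ x) ^ 2 * φ x ^ 2 + H (φ x) * φ x) * ‖V x‖ ^ 2 := by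
      intro x hx
      have := (((hdH (φ x)).comp_hasFDerivAt x (hφV x hx)).mul (hφV x hx)).fderiv
      rw [show (fun x => H (φ x) * φ x) = (H ∘ φ) * φ from rfl, this]
      simp
      ring
    have ibp := integral_mul_divergence hU hV hw hcw hsw
    have i1 : Integrable fun x => H (φ x) * φ x * divergence V x :=
      integrable_mul_of_continuousOn hU hw.continuous hcw hsw (hV.continuousOn_divergence hU)
    have i2 : Integrable fun x => H (φ x) * φ x * ‖V x‖ ^ 2 :=
      integrable_mul_of_continuousOn hU hw.continuous hcw hsw (hV.continuousOn.norm.pow 2)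
    have i3 : Integrable fun x => fderiv ℝ (fun x => H (φ x) * φ x) x (V x) := by
      have hc : HasCompactSupport fun x => fderiv ℝ (fun x => H (φ x) * φ x) x (V x) := by
        refine HasCompactSupport.mono' (hcw.fderiv ℝ) ?_
        refine Set.Subset.trans ?_ subset_closure
        intro x hx
        contrapose! hx
        simp only [Function.mem_support, not_not] at hx ⊢
        simp [hx]
      refine Continuous.integrable_of_hasCompactSupport ?_ hc
      refine continuous_of_tsupport fun x hx => ?_
      have hxU : x ∈ U := by
        refine hsw (tsupport_fderiv_subset ℝ (closure_mono ?_ hx))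
        intro y hy
        contrapose! hy
        simp only [Function.mem_support, not_not] at hy ⊢
        simp [hy]
      exact (hw.continuous_fderiv one_ne_zero).continuousAt.clm_apply
        (hV.continuousOn.continuousAt (hU.mem_nhds hxU))
    have hoff : ∀ x ∉ U, fderiv ℝ (fun x => h (φ x)) x = 0 ∧
        fderiv ℝ (fun x => H (φ x) * φ x) x = 0 ∧ φ x = 0 := by
      intro x hx
      refine ⟨?_, ?_, hφ0 x hx⟩
      · exact image_eq_zero_of_notMem_tsupport fun h => hx (hsf (tsupport_fderiv_subset ℝ h))
      · exact image_eq_zero_of_notMem_tsupport fun h => hx (hsw (tsupport_fderiv_subset ℝ h))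
    have hpt : ∀ x, ‖fderiv ℝ (fun x => h (φ x)) x‖ ^ 2
        = fderiv ℝ (fun x => H (φ x) * φ x) x (V x) - H (φ x) * φ x * ‖V x‖ ^ 2 := by
      intro x
      by_cases hx : x ∈ U
      · rw [hfd x hx, hwd x hx]
        ring
      · obtain ⟨e1, e2, e3⟩ := hoff x hx
        simp [e1, e2, e3]
    have hupper : ∫ x, ‖fderiv ℝ (fun x => h (φ x)) x‖ ^ 2 ≤ μ * ∫ x, φ x ^ 2 := by
      calc ∫ x, ‖fderiv ℝ (fun x => h (φ x)) x‖ ^ 2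
          = ∫ x, -(H (φ x) * φ x * divergence V x + H (φ x) * φ x * ‖V x‖ ^ 2) := by
            simp only [hpt]
            rw [integral_sub i3 i2, integral_neg, integral_add i1 i2, ibp]
            ring
        _ ≤ ∫ x, μ * φ x ^ 2 := by
            refine integral_mono (i1.add i2).neg (iφ2.const_mul μ) fun x => ?_
            by_cases hx : x ∈ U
            · obtain ⟨-, -, b3, b4⟩ := hbd (φ x) (hnn x)
              have e1 : 0 ≤ H (φ x) * φ x := mul_nonneg b3 (hnn x)
              have e2 : H (φ x) * φ x ≤ φ x ^ 2 := by nlinarith [hnn x]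
              have e3 := mul_le_mul_of_nonneg_left (hμ x hx) e1
              have e4 := mul_le_mul_of_nonneg_left e2 hμ0
              simp only
              linarith
            · simp [hφ0 x hx]
        _ = _ := integral_const_mul _ _
    have hlower : (∫ x, φ x ^ 2) - 4 * ε * ∫ x, φ x ≤ ∫ x, h (φ x) ^ 2 := by
      rw [← integral_const_mul, ← integral_sub iφ2 (iφ.const_mul _)]
      have ihf : Integrable fun x => h (φ x) ^ 2 := by
        refine (hf.continuous.pow 2).integrable_of_hasCompactSupport ?_
        simp only [sq]
        exact hcf.mul_right
      refine integral_mono (iφ2.sub (iφ.const_mul _)) ihf fun x => ?_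
      obtain ⟨b1, b2, -, -⟩ := hbd (φ x) (hnn x)
      have := hnn x
      simp only
      rcases le_total (φ x) (2 * ε) with hle | hle
      · nlinarith [sq_nonneg (h (φ x))]
      · nlinarith [mul_self_le_mul_self (sub_nonneg.2 hle) b2]
    calc _ ≤ lam * ∫ x, h (φ x) ^ 2 := mul_le_mul_of_nonneg_left hlower hlam
      _ ≤ _ := dirichletEigenvalue_mul_le hf hcf (hsf.trans hUΩ)
      _ ≤ _ := hupper
  by_contra hlt
  rw [not_le] at hlt
  have hpos : 0 < (lam - μ) * ∫ x, φ x ^ 2 := mul_pos (sub_pos.2 hlt) hI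
  have hC : 0 < 4 * lam * (∫ x, φ x) + 1 := by positivity
  have := main (((lam - μ) * ∫ x, φ x ^ 2) / (4 * lam * (∫ x, φ x) + 1)) (div_pos hpos hC)
  have hq : ((lam - μ) * ∫ x, φ x ^ 2) / (4 * lam * (∫ x, φ x) + 1)
      * (4 * lam * (∫ x, φ x) + 1) = (lam - μ) * ∫ x, φ x ^ 2 := div_mul_cancel₀ _ hC.ne'
  have := div_pos hpos hC
  nlinarith

end TestFunctions
section Box

variable {n : ℕ}

/-- The open box centred at `c` with half side length `π / (2 * k)`. -/
def openBox (k : ℝ) (c : EuclideanSpace ℝ (Fin n)) : Set (EuclideanSpace ℝ (Fin n)) :=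
  {x | ∀ i, k * (x i - c i) ∈ Set.Ioo (-(π / 2)) (π / 2)}

/-- The logarithmic gradient of `∏ i, cos (k * (x i - c i))`. -/
noncomputable def boxField (k : ℝ) (c x : EuclideanSpace ℝ (Fin n)) : EuclideanSpace ℝ (Fin n) :=
  WithLp.toLp 2 fun i => -k * Real.tan (k * (x i - c i))

/-- The first Dirichlet eigenfunction of the box, extended by zero. -/
noncomputable def boxEigenfunction (k : ℝ) (c x : EuclideanSpace ℝ (Fin n)) : ℝ :=
  ∏ i, Real.cos (max (-(π / 2)) (min (π / 2) (k * (x i - c i))))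

variable {k : ℝ} {c x : EuclideanSpace ℝ (Fin n)}

lemma isOpen_openBox (k : ℝ) (c : EuclideanSpace ℝ (Fin n)) : IsOpen (openBox k c) := by
  simp only [openBox, Set.ofPred_forall]
  exact isOpen_iInter_of_finite fun i => isOpen_Ioo.preimage (by fun_prop)

lemma cos_ne_zero_of_mem_openBox (hx : x ∈ openBox k c) (i : Fin n) :
    Real.cos (k * (x i - c i)) ≠ 0 := (Real.cos_pos_of_mem_Ioo (hx i)).ne'

lemma hasFDerivAt_box_coord (k : ℝ) (c x : EuclideanSpace ℝ (Fin n)) (i : Fin n) :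
    HasFDerivAt (fun y : EuclideanSpace ℝ (Fin n) => k * (y i - c i))
      (k • EuclideanSpace.proj (𝕜 := ℝ) i) x :=
  ((EuclideanSpace.proj (𝕜 := ℝ) i).hasFDerivAt.sub_const (c i)).const_mul k

lemma contDiffOn_boxField (k : ℝ) (c : EuclideanSpace ℝ (Fin n)) :
    ContDiffOn ℝ 1 (boxField k c) (openBox k c) := by
  refine contDiffOn_euclidean.2 fun i x hx => ContDiffAt.contDiffWithinAt ?_
  refine contDiffAt_const.mul ?_
  exact (Real.contDiffAt_tan.2 (cos_ne_zero_of_mem_openBox hx i)).comp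
    (f := fun y : EuclideanSpace ℝ (Fin n) => k * (y i - c i)) x (by fun_prop)

lemma divergence_boxField_add_sq (hx : x ∈ openBox k c) :
    divergence (boxField k c) x + ‖boxField k c x‖ ^ 2 = -(n * k ^ 2) := by
  have h : ∀ i, fderiv ℝ (fun y => boxField k c y i) x (EuclideanSpace.single i 1)
      + ‖boxField k c x i‖ ^ 2 = -k ^ 2 := by
    intro i
    have hc := cos_ne_zero_of_mem_openBox hx i
    have := (((Real.hasDerivAt_tan hc).comp_hasFDerivAt x
      (hasFDerivAt_box_coord k c x i)).const_mul (-k)).fderiv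
    rw [show (fun y => boxField k c y i)
      = fun y => -k * (Real.tan ∘ fun y : EuclideanSpace ℝ (Fin n) => k * (y i - c i)) y from rfl,
      this]
    simp only [boxField, Real.norm_eq_abs, sq_abs, Real.tan_eq_sin_div_cos]
    simp
    field_simp
    linear_combination k ^ 2 * Real.sin_sq_add_cos_sq (k * (x i - c i))
  rw [EuclideanSpace.norm_sq_eq, divergence, ← Finset.sum_add_distrib,
    Finset.sum_congr rfl fun i _ => h i]
  simp

lemma continuous_boxEigenfunction (k : ℝ) (c : EuclideanSpace ℝ (Fin n)) :
    Continuous (boxEigenfunction k c) := by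
  unfold boxEigenfunction
  fun_prop

lemma boxEigenfunction_eq_zero (hx : x ∉ openBox k c) : boxEigenfunction k c x = 0 := by
  simp only [openBox, Set.mem_ofPred_eq, not_forall, Set.mem_Ioo, not_and_or, not_lt] at hx
  obtain ⟨i, hi⟩ := hx
  refine Finset.prod_eq_zero (Finset.mem_univ i) ?_
  have := Real.pi_pos
  rcases hi with hi | hi
  · rw [max_eq_left ((min_le_right _ _).trans hi), Real.cos_neg, Real.cos_pi_div_two]
  · rw [min_eq_left hi, max_eq_right (by linarith), Real.cos_pi_div_two]

lemma boxEigenfunction_eqOn (k : ℝ) (c : EuclideanSpace ℝ (Fin n)) :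
    Set.EqOn (boxEigenfunction k c) (fun x => ∏ i, Real.cos (k * (x i - c i))) (openBox k c) :=
  fun x hx => Finset.prod_congr rfl fun i _ => by
    rw [min_eq_right (hx i).2.le, max_eq_right (hx i).1.le]

lemma boxEigenfunction_pos (hx : x ∈ openBox k c) : 0 < boxEigenfunction k c x := by
  rw [boxEigenfunction_eqOn k c hx]
  exact Finset.prod_pos fun i _ => Real.cos_pos_of_mem_Ioo (hx i)

lemma contDiffOn_boxEigenfunction (k : ℝ) (c : EuclideanSpace ℝ (Fin n)) :
    ContDiffOn ℝ (⊤ : ℕ∞) (boxEigenfunction k c) (openBox k c) := by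
  refine ContDiffOn.congr (ContDiff.contDiffOn ?_) (boxEigenfunction_eqOn k c)
  refine contDiff_prod fun i _ => ?_
  fun_prop

lemma hasFDerivAt_boxEigenfunction (hx : x ∈ openBox k c) :
    HasFDerivAt (boxEigenfunction k c)
      (boxEigenfunction k c x • innerSL ℝ (boxField k c x)) x := by
  have h := HasFDerivAt.finsetProd (u := Finset.univ) (x := x)
    (g := fun i (y : EuclideanSpace ℝ (Fin n)) => Real.cos (k * (y i - c i)))
    fun i _ => (hasFDerivAt_box_coord k c x i).cos
  refine (h.congr_fderiv ?_).congr_of_eventuallyEq ?_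
  · ext v
    rw [boxEigenfunction_eqOn k c hx]
    simp only [sum_apply, smul_apply, smul_eq_mul,
      innerSL_apply_apply, PiLp.inner_apply, Finset.mul_sum, boxField]
    refine Finset.sum_congr rfl fun i _ => ?_
    have hc := cos_ne_zero_of_mem_openBox hx i
    rw [← Finset.mul_prod_erase Finset.univ _ (Finset.mem_univ i), Real.tan_eq_sin_div_cos]
    simp
    field_simp
  · filter_upwards [(isOpen_openBox k c).mem_nhds hx] with y hy
    rw [boxEigenfunction_eqOn k c hy]

end Box

section Radial

variable {n : ℕ}

lemma isOpen_annulus (n : ℕ) (a b : ℝ) : IsOpen (annulus n a b) :=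
  isOpen_Ioo.preimage (f := fun x : EuclideanSpace ℝ (Fin n) => ‖x‖) continuous_norm

lemma hasFDerivAt_norm_of_ne_zero {E : Type*} [NormedAddCommGroup E] [InnerProductSpace ℝ E]
    {x : E} (hx : x ≠ 0) :
    HasFDerivAt (fun y : E => ‖y‖) (‖x‖⁻¹ • innerSL ℝ x) x := by
  have h := (hasStrictFDerivAt_norm_sq x).hasFDerivAt.sqrt (by simpa using hx)
  simp only [Real.sqrt_sq (norm_nonneg _)] at h
  refine h.congr_fderiv ?_
  ext v
  simp
  ring

lemma divergence_radial {ψ : ℝ → ℝ} {ψ' : ℝ} {x : EuclideanSpace ℝ (Fin n)} (hx : x ≠ 0)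
    (hψ : HasDerivAt ψ ψ' ‖x‖) :
    divergence (fun y => ψ ‖y‖ • y) x = n * ψ ‖x‖ + ‖x‖ * ψ' := by
  have hx' : ‖x‖ ≠ 0 := norm_ne_zero_iff.2 hx
  have h : ∀ i, fderiv ℝ (fun y : EuclideanSpace ℝ (Fin n) => (ψ ‖y‖ • y) i) x
      (EuclideanSpace.single i 1) = ψ ‖x‖ + ψ' * ‖x‖⁻¹ * ‖x i‖ ^ 2 := by
    intro i
    have := ((hψ.comp_hasFDerivAt x (hasFDerivAt_norm_of_ne_zero hx)).mul
      (EuclideanSpace.proj (𝕜 := ℝ) i).hasFDerivAt).fderiv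
    rw [show (fun y : EuclideanSpace ℝ (Fin n) => (ψ ‖y‖ • y) i)
      = (ψ ∘ fun y => ‖y‖) * ⇑(EuclideanSpace.proj (𝕜 := ℝ) i) from rfl, this]
    simp [EuclideanSpace.inner_single_right]
    ring
  rw [divergence, Finset.sum_congr rfl fun i _ => h i, Finset.sum_add_distrib, ← Finset.mul_sum,
    ← EuclideanSpace.norm_sq_eq]
  simp
  field_simp

/-- The logarithmic derivative of `r ↦ r ^ (-(n - 1) / 2) * sin (k * (r - a))`, divided by `r`. -/
noncomputable def radialProfile (n : ℕ) (k a r : ℝ) : ℝ :=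
  -((n - 1) / 2) / r ^ 2 + k * Real.cos (k * (r - a)) / (r * Real.sin (k * (r - a)))

/-- The logarithmic gradient of `‖x‖ ^ (-(n - 1) / 2) * sin (k * (‖x‖ - a))`. -/
noncomputable def radialField (k a : ℝ) (x : EuclideanSpace ℝ (Fin n)) :
    EuclideanSpace ℝ (Fin n) :=
  radialProfile n k a ‖x‖ • x

/-- The test function `‖x‖ ^ (-(n - 1) / 2) * sin (π * (‖x‖ - a) / (b - a))`, extended by zero. -/
noncomputable def radialTestFunction (a b : ℝ) (x : EuclideanSpace ℝ (Fin n)) : ℝ :=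
  max a (min b ‖x‖) ^ (-(((n : ℝ) - 1) / 2)) *
    Real.sin (π / (b - a) * (max a (min b ‖x‖) - a))

variable {a b : ℝ} {x : EuclideanSpace ℝ (Fin n)}

lemma ne_zero_of_mem_annulus (ha : 0 < a) (hx : x ∈ annulus n a b) : x ≠ 0 :=
  norm_pos_iff.1 (ha.trans hx.1)

lemma sin_pos_of_mem_annulus (hx : x ∈ annulus n a b) :
    0 < Real.sin (π / (b - a) * (‖x‖ - a)) := by
  obtain ⟨h1, h2⟩ := hx
  have hba : 0 < b - a := by linarith
  refine Real.sin_pos_of_pos_of_lt_pi (mul_pos (div_pos Real.pi_pos hba) (by linarith)) ?_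
  rw [div_mul_eq_mul_div, div_lt_iff₀ hba]
  exact mul_lt_mul_of_pos_left (by linarith) Real.pi_pos

lemma contDiffOn_radialField (ha : 0 < a) :
    ContDiffOn ℝ 1 (radialField (π / (b - a)) a) (annulus n a b) := by
  intro x hx
  refine ContDiffAt.contDiffWithinAt ?_
  have h0 := ne_zero_of_mem_annulus ha hx
  have hs := (sin_pos_of_mem_annulus hx).ne'
  have hn : ContDiffAt ℝ 1 (fun y : EuclideanSpace ℝ (Fin n) => ‖y‖) x := contDiffAt_norm ℝ h0
  have hr : ‖x‖ ≠ 0 := norm_ne_zero_iff.2 h0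
  have hθ : ContDiffAt ℝ 1
      (fun y : EuclideanSpace ℝ (Fin n) => π / (b - a) * (‖y‖ - a)) x :=
    contDiffAt_const.mul (hn.sub contDiffAt_const)
  suffices hψ : ContDiffAt ℝ 1 (fun y : EuclideanSpace ℝ (Fin n) =>
      radialProfile n (π / (b - a)) a ‖y‖) x from hψ.smul contDiffAt_id
  refine ContDiffAt.add ?_ ?_
  · exact contDiffAt_const.div (hn.pow 2) (pow_ne_zero 2 hr)
  · exact (contDiffAt_const.mul hθ.cos).div (hn.mul hθ.sin) (mul_ne_zero hr hs)

lemma divergence_radialField_add_sq (ha : 0 < a) (hx : x ∈ annulus n a b) :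
    divergence (radialField (π / (b - a)) a) x + ‖radialField (π / (b - a)) a x‖ ^ 2
      = -((π / (b - a)) ^ 2 + (n - 1) * (n - 3) / 4 / ‖x‖ ^ 2) := by
  have h0 := ne_zero_of_mem_annulus ha hx
  have hs := (sin_pos_of_mem_annulus hx).ne'
  have hr : ‖x‖ ≠ 0 := norm_ne_zero_iff.2 h0
  set k := π / (b - a)
  have hθ : HasDerivAt (fun r : ℝ => k * (r - a)) k ‖x‖ := by
    simpa using ((hasDerivAt_id ‖x‖).sub_const a).const_mul k
  have hψ := (((hasDerivAt_const ‖x‖ (-(((n : ℝ) - 1) / 2))).div (hasDerivAt_pow 2 ‖x‖)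
    (pow_ne_zero 2 hr))).add ((hθ.cos.const_mul k).div ((hasDerivAt_id ‖x‖).mul hθ.sin)
    (mul_ne_zero hr hs))
  have hd := divergence_radial (ψ := radialProfile n k a) h0 hψ
  unfold radialField
  rw [hd, norm_smul, mul_pow, Real.norm_eq_abs, sq_abs, radialProfile]
  simp only [Pi.mul_apply, id_eq]
  have hsc := Real.sin_sq_add_cos_sq (k * (‖x‖ - a))
  generalize Real.sin (k * (‖x‖ - a)) = s at *
  generalize Real.cos (k * (‖x‖ - a)) = t at *
  generalize ‖x‖ = r at *
  field_simp
  ring_nf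

lemma continuous_radialTestFunction (ha : 0 < a) (b : ℝ) :
    Continuous (radialTestFunction (n := n) a b) := by
  unfold radialTestFunction
  refine Continuous.mul (Continuous.rpow_const (by fun_prop) fun x => Or.inl ?_) (by fun_prop)
  exact (ha.trans_le (le_max_left _ _)).ne'

lemma radialTestFunction_eq_zero (hab : a < b) (hx : x ∉ annulus n a b) :
    radialTestFunction a b x = 0 := by
  have hba : b - a ≠ 0 := by linarith
  simp only [annulus, Set.mem_ofPred_eq, not_and_or, not_lt] at hx
  rw [radialTestFunction]
  rcases hx with hx | hx
  · rw [max_eq_left ((min_le_right _ _).trans hx)]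
    simp
  · rw [min_eq_left hx, max_eq_right hab.le, div_mul_cancel₀ _ hba]
    simp

lemma radialTestFunction_eqOn (a b : ℝ) :
    Set.EqOn (radialTestFunction (n := n) a b) (fun x => ‖x‖ ^ (-(((n : ℝ) - 1) / 2)) *
      Real.sin (π / (b - a) * (‖x‖ - a))) (annulus n a b) := fun x hx => by
  rw [radialTestFunction, min_eq_right hx.2.le, max_eq_right hx.1.le]

lemma radialTestFunction_pos (ha : 0 < a) (hx : x ∈ annulus n a b) :
    0 < radialTestFunction a b x := by
  rw [radialTestFunction_eqOn a b hx]
  exact mul_pos (Real.rpow_pos_of_pos (ha.trans hx.1) _) (sin_pos_of_mem_annulus hx)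

lemma contDiffOn_radialTestFunction (ha : 0 < a) (b : ℝ) :
    ContDiffOn ℝ (⊤ : ℕ∞) (radialTestFunction (n := n) a b) (annulus n a b) := by
  refine ContDiffOn.congr (fun x hx => ContDiffAt.contDiffWithinAt ?_)
    (radialTestFunction_eqOn a b)
  have h0 := ne_zero_of_mem_annulus ha hx
  have hn : ContDiffAt ℝ (⊤ : ℕ∞) (fun y : EuclideanSpace ℝ (Fin n) => ‖y‖) x :=
    contDiffAt_norm ℝ h0
  exact (hn.rpow_const_of_ne (norm_ne_zero_iff.2 h0)).mul
    (contDiffAt_const.mul (hn.sub contDiffAt_const)).sin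

lemma hasFDerivAt_radialTestFunction (ha : 0 < a) (hx : x ∈ annulus n a b) :
    HasFDerivAt (radialTestFunction a b)
      (radialTestFunction a b x • innerSL ℝ (radialField (π / (b - a)) a x)) x := by
  have h0 := ne_zero_of_mem_annulus ha hx
  have hs := (sin_pos_of_mem_annulus hx).ne'
  have hr : ‖x‖ ≠ 0 := norm_ne_zero_iff.2 h0
  have hθ : HasDerivAt (fun r : ℝ => π / (b - a) * (r - a)) (π / (b - a)) ‖x‖ := by
    simpa using ((hasDerivAt_id ‖x‖).sub_const a).const_mul (π / (b - a))
  have hu := ((Real.hasDerivAt_rpow_const (p := -(((n : ℝ) - 1) / 2)) (Or.inl hr)).mul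
    hθ.sin).comp_hasFDerivAt x (hasFDerivAt_norm_of_ne_zero h0)
  refine (hu.congr_fderiv ?_).congr_of_eventuallyEq ?_
  · rw [radialTestFunction_eqOn a b hx, radialField, radialProfile, map_smul, smul_smul, smul_smul]
    congr 1
    rw [Real.rpow_sub_one hr]
    beta_reduce
    generalize Real.sin (π / (b - a) * (‖x‖ - a)) = s at *
    generalize π / (b - a) = k at *
    field_simp
  · filter_upwards [(isOpen_annulus n a b).mem_nhds hx] with y hy
    exact radialTestFunction_eqOn a b hy

end Radial
section Bounds

variable {n : ℕ} {a b : ℝ}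

lemma annulus_nonempty (hn : 0 < n) (ha : 0 < a) (hab : a < b) : (annulus n a b).Nonempty := by
  refine ⟨EuclideanSpace.single ⟨0, hn⟩ ((a + b) / 2), ?_⟩
  have : ‖(a + b) / 2‖ = (a + b) / 2 := by
    rw [Real.norm_eq_abs, abs_of_pos (by linarith)]
  simp only [annulus, Set.mem_ofPred_eq, PiLp.norm_single, this]
  constructor <;> linarith

lemma isBounded_annulus (n : ℕ) (a b : ℝ) : Bornology.IsBounded (annulus n a b) :=
  Metric.isBounded_ball.subset fun _ hx => mem_ball_zero_iff.2 hx.2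

lemma annulus_subset_openBox (hb : 0 < b) : annulus n a b ⊆ openBox (π / (2 * b)) 0 := by
  intro x hx i
  have h := (PiLp.norm_apply_le x i).trans_lt hx.2
  rw [Real.norm_eq_abs, abs_lt] at h
  have hk : 0 < π / (2 * b) := by positivity
  have e : π / (2 * b) * b = π / 2 := by field_simp
  simp only [PiLp.zero_apply, sub_zero]
  constructor
  · rw [← e, ← mul_neg]
    exact mul_lt_mul_of_pos_left h.1 hk
  · rw [← e]
    exact mul_lt_mul_of_pos_left h.2 hk

lemma le_dirichletEigenvalue_annulus_of_box (hn : 0 < n) (ha : 0 < a) (hab : a < b) :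
    n * (π / (2 * b)) ^ 2 ≤ dirichletEigenvalue n (annulus n a b) :=
  le_dirichletEigenvalue (isOpen_openBox _ _) (contDiffOn_boxField _ _)
    (fun _ hx => (divergence_boxField_add_sq hx).le) (isOpen_annulus n a b)
    (annulus_nonempty hn ha hab) (annulus_subset_openBox (ha.trans hab))

lemma le_dirichletEigenvalue_annulus_of_radial (hn : 0 < n) (ha : 0 < a) (hab : a < b) {ν : ℝ}
    (hν : ∀ r, a < r → r < b → ν ≤ ((n : ℝ) - 1) * (n - 3) / 4 / r ^ 2) :
    (π / (b - a)) ^ 2 + ν ≤ dirichletEigenvalue n (annulus n a b) := by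
  refine le_dirichletEigenvalue (isOpen_annulus n a b) (contDiffOn_radialField ha)
    (fun x hx => ?_) (isOpen_annulus n a b) (annulus_nonempty hn ha hab) subset_rfl
  rw [divergence_radialField_add_sq ha hx]
  linarith [hν ‖x‖ hx.1 hx.2]

lemma dirichletEigenvalue_annulus_le_of_radial (hn : 0 < n) (ha : 0 < a) (hab : a < b) {ν : ℝ}
    (hν0 : 0 ≤ (π / (b - a)) ^ 2 + ν)
    (hν : ∀ r, a < r → r < b → ((n : ℝ) - 1) * (n - 3) / 4 / r ^ 2 ≤ ν) :
    dirichletEigenvalue n (annulus n a b) ≤ (π / (b - a)) ^ 2 + ν := by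
  refine dirichletEigenvalue_le (isOpen_annulus n a b) (isBounded_annulus n a b)
    (annulus_nonempty hn ha hab) subset_rfl (contDiffOn_radialField ha) hν0 (fun x hx => ?_)
    (continuous_radialTestFunction ha b) (fun x hx => radialTestFunction_eq_zero hab hx)
    (fun x hx => radialTestFunction_pos ha hx) (contDiffOn_radialTestFunction ha b)
    (fun x hx => hasFDerivAt_radialTestFunction ha hx)
  rw [divergence_radialField_add_sq ha hx]
  linarith [hν ‖x‖ hx.1 hx.2]

lemma openBox_subset_ball (hn : 0 < n) {k : ℝ} (hk : 0 < k) (c : EuclideanSpace ℝ (Fin n)) :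
    openBox k c ⊆ Metric.ball c (√n * π / (2 * k)) := by
  intro x hx
  have hn' : (0 : ℝ) < n := by exact_mod_cast hn
  have hpos : 0 < √n * π / (2 * k) := by positivity
  rw [mem_ball_iff_norm, ← sq_lt_sq₀ (norm_nonneg _) hpos.le, EuclideanSpace.norm_sq_eq]
  have h : ∀ i, ‖(x - c) i‖ ^ 2 < (π / (2 * k)) ^ 2 := by
    intro i
    obtain ⟨h1, h2⟩ := hx i
    have e : π / (2 * k) = π / 2 / k := by field_simp
    rw [Real.norm_eq_abs, sq_abs, PiLp.sub_apply]
    refine sq_lt_sq' ?_ ?_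
    · rw [e, ← neg_div, div_lt_iff₀ hk]
      linarith
    · rw [e, lt_div_iff₀ hk]
      linarith
  have : Nonempty (Fin n) := ⟨⟨0, hn⟩⟩
  calc ∑ i, ‖(x - c) i‖ ^ 2 < ∑ _i : Fin n, (π / (2 * k)) ^ 2 :=
        Finset.sum_lt_sum_of_nonempty Finset.univ_nonempty fun i _ => h i
    _ = (√n * π / (2 * k)) ^ 2 := by
        simp only [Finset.sum_const, Finset.card_univ, Fintype.card_fin, nsmul_eq_mul]
        rw [mul_div_assoc, mul_pow, Real.sq_sqrt hn'.le]

lemma dirichletEigenvalue_annulus_le_of_box (hn : 0 < n) (ha : 0 < a) (hab : a < b) :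
    dirichletEigenvalue n (annulus n a b) ≤ (n * π / (b - a)) ^ 2 := by
  have hn' : (0 : ℝ) < n := by exact_mod_cast hn
  have hba : 0 < b - a := sub_pos.2 hab
  set k := √n * π / (b - a) with hk_def
  have hk : 0 < k := by positivity
  set c : EuclideanSpace ℝ (Fin n) := EuclideanSpace.single ⟨0, hn⟩ ((a + b) / 2) with hc_def
  have hc : ‖c‖ = (a + b) / 2 := by
    rw [hc_def, PiLp.norm_single, Real.norm_eq_abs, abs_of_pos (by linarith)]
  have hr : √n * π / (2 * k) = (b - a) / 2 := by
    rw [hk_def]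
    field_simp
  have hball := openBox_subset_ball hn hk c
  rw [hr] at hball
  have hsub : openBox k c ⊆ annulus n a b := by
    intro x hx
    have h := mem_ball_iff_norm.1 (hball hx)
    have h1 := abs_le.1 (abs_norm_sub_norm_le x c)
    rw [hc] at h1
    constructor <;> linarith [h1.1, h1.2]
  have hμ : (n * π / (b - a)) ^ 2 = n * k ^ 2 := by
    rw [hk_def, div_pow, div_pow, mul_pow, mul_pow, Real.sq_sqrt hn'.le]
    ring
  rw [hμ]
  refine dirichletEigenvalue_le (isOpen_openBox k c) (Metric.isBounded_ball.subset hball)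
    ⟨c, fun i => ?_⟩ hsub (contDiffOn_boxField k c) (by positivity)
    (fun x hx => (divergence_boxField_add_sq hx).ge)
    (continuous_boxEigenfunction k c) (fun x hx => boxEigenfunction_eq_zero hx)
    (fun x hx => boxEigenfunction_pos hx) (contDiffOn_boxEigenfunction k c)
    (fun x hx => hasFDerivAt_boxEigenfunction hx)
  have := Real.pi_pos
  simp only [sub_self, mul_zero]
  constructor <;> linarith

end Bounds

theorem stmt_0 (n : ℕ) (hn : 2 ≤ n) (a b : ℝ) (ha : 0 < a) (hab : a < b) :
    Cone n (b / a) / (b - a) ^ 2 ≤ dirichletEigenvalue n (annulus n a b) ∧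
    dirichletEigenvalue n (annulus n a b) ≤ Ctwo n (b / a) / (b - a) ^ 2 := by
  have hn0 : 0 < n := by omega
  have hb : 0 < b := ha.trans hab
  have hba : 0 < b - a := sub_pos.2 hab
  have hba2 : 0 < (b - a) ^ 2 := by positivity
  have ex : (1 - 1 / (b / a)) ^ 2 = (b - a) ^ 2 / b ^ 2 := by field_simp
  have ex' : (b / a - 1) ^ 2 = (b - a) ^ 2 / a ^ 2 := by field_simp
  have eπ : (π / (b - a)) ^ 2 * (b - a) ^ 2 = π ^ 2 := by field_simp
  have hl := le_dirichletEigenvalue_annulus_of_box hn0 ha hab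
  have hu := dirichletEigenvalue_annulus_le_of_box hn0 ha hab
  rw [div_le_iff₀ hba2, le_div_iff₀ hba2]
  have hl' := mul_le_mul_of_nonneg_right hl hba2.le
  have hu' := mul_le_mul_of_nonneg_right hu hba2.le
  have hsq : ∀ r, a < r → a ^ 2 ≤ r ^ 2 := fun r h => pow_le_pow_left₀ ha.le h.le 2
  have hsq' : ∀ r, a < r → r < b → r ^ 2 ≤ b ^ 2 := fun r h h' =>
    pow_le_pow_left₀ (ha.trans h).le h'.le 2
  have hr2 : ∀ r, a < r → 0 < r ^ 2 := fun r h => pow_pos (ha.trans h) 2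
  by_cases h3 : 3 ≤ n
  · have h3' : (3 : ℝ) ≤ n := by exact_mod_cast h3
    have hq : 0 ≤ ((n : ℝ) - 1) * (n - 3) / 4 := by
      have := mul_nonneg (by linarith : (0 : ℝ) ≤ n - 1) (by linarith : (0 : ℝ) ≤ n - 3)
      linarith
    have hl2 := mul_le_mul_of_nonneg_right (le_dirichletEigenvalue_annulus_of_radial hn0 ha hab
      (ν := ((n : ℝ) - 1) * (n - 3) / 4 / b ^ 2) fun r h h' =>
        div_le_div_of_nonneg_left hq (hr2 r h) (hsq' r h h')) hba2.le
    have hu2 := mul_le_mul_of_nonneg_right (dirichletEigenvalue_annulus_le_of_radial hn0 ha hab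
      (ν := ((n : ℝ) - 1) * (n - 3) / 4 / a ^ 2) (by positivity) fun r h _ =>
        div_le_div_of_nonneg_left hq (by positivity) (hsq r h)) hba2.le
    simp only [Cone, Ctwo, if_pos h3, ex, ex']
    refine ⟨max_le (le_trans (le_of_eq ?_) hl') (le_trans (le_of_eq ?_) hl2),
      le_min (hu'.trans (le_of_eq ?_)) (hu2.trans (le_of_eq ?_))⟩
    · field_simp
      ring
    · rw [add_mul, eπ]
      ring
    · field_simp
    · rw [add_mul, eπ]
      ring
  · obtain rfl : n = 2 := by omega
    have hq : ((2 : ℕ) - 1 : ℝ) * ((2 : ℕ) - 3) / 4 = -(1 / 4) := by norm_num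
    have hl2 := mul_le_mul_of_nonneg_right (le_dirichletEigenvalue_annulus_of_radial hn0 ha hab
      (ν := -(1 / 4 / a ^ 2)) fun r h _ => by
        rw [hq, neg_div]
        exact neg_le_neg (div_le_div_of_nonneg_left (by norm_num) (by positivity) (hsq r h)))
      hba2.le
    have hpos : 0 ≤ (π / (b - a)) ^ 2 + -(1 / 4 / b ^ 2) := by
      have h1 : 1 / 4 / b ^ 2 ≤ π ^ 2 / (b - a) ^ 2 :=
        div_le_div₀ (by positivity) (by nlinarith [Real.pi_gt_three]) hba2
          (pow_le_pow_left₀ hba.le (by linarith) 2)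
      rw [div_pow]
      linarith
    have hu2 := mul_le_mul_of_nonneg_right (dirichletEigenvalue_annulus_le_of_radial hn0 ha hab
      (ν := -(1 / 4 / b ^ 2)) hpos fun r h h' => by
        rw [hq, neg_div]
        exact neg_le_neg (div_le_div_of_nonneg_left (by norm_num) (hr2 r h) (hsq' r h h')))
      hba2.le
    simp only [Cone, Ctwo, if_neg h3, ex, ex']
    refine ⟨max_le (le_trans (le_of_eq ?_) hl') (le_trans (le_of_eq ?_) hl2),
      le_min (hu'.trans (le_of_eq ?_)) (hu2.trans (le_of_eq ?_))⟩
    · push_cast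
      field_simp
    · rw [add_mul, eπ]
      ring
    · push_cast
      field_simp
      ring
    · rw [add_mul, eπ]
      ring
end

section
/- Let (X,d) be a metric space and let U ⊆ X be a nonempty open connected set with compact closure and nonempty boundary ∂U, such that any two points of U are joined by a rectifiable path in U. If U is (C₀,c₀)-inner uniform, then diam(U) ≤ diam_U ≤ (8/c₀)·diam(U), where diam(U) is the diameter of U with respect to d and diam_U is the diameter with respect to the intrinsic distance d_U. -/
open Real MeasureTheory

/-- The intrinsic (geodesic) distance in `U`: the infimum of lengths of continuous paths
joining `x` to `y` within `U`. -/
noncomputable def intrinsicDist {X : Type*} [MetricSpace X] (U : Set X) (x y : X) : ℝ :=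
  sInf {L : ℝ | ∃ γ : ℝ → X, ContinuousOn γ (Set.Icc 0 1) ∧ γ 0 = x ∧ γ 1 = y ∧
    (∀ t ∈ Set.Icc (0 : ℝ) 1, γ t ∈ U) ∧ eVariationOn γ (Set.Icc 0 1) ≠ ⊤ ∧
    L = (eVariationOn γ (Set.Icc 0 1)).toReal}

/-- The diameter of `U` with respect to the intrinsic distance. -/
noncomputable def intrinsicDiam {X : Type*} [MetricSpace X] (U : Set X) : ℝ :=
  sSup {d : ℝ | ∃ x ∈ U, ∃ y ∈ U, d = intrinsicDist U x y}

/-- `U` is `(C₀, c₀)`-inner uniform: any two points of `U` are joined by a path in `U`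
of length at most `C₀` times their intrinsic distance, every point `z` of which satisfies
`dist (z, ∂U) ≥ c₀ · d_U(x,z) · d_U(y,z) / d_U(x,y)`. -/
def InnerUniform {X : Type*} [MetricSpace X] (U : Set X) (C₀ c₀ : ℝ) : Prop :=
  ∀ x ∈ U, ∀ y ∈ U, ∃ γ : ℝ → X, ContinuousOn γ (Set.Icc 0 1) ∧ γ 0 = x ∧ γ 1 = y ∧
    (∀ t ∈ Set.Icc (0 : ℝ) 1, γ t ∈ U) ∧
    (eVariationOn γ (Set.Icc 0 1)).toReal ≤ C₀ * intrinsicDist U x y ∧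
    eVariationOn γ (Set.Icc 0 1) ≠ ⊤ ∧
    ∀ t ∈ Set.Icc (0 : ℝ) 1,
      c₀ * intrinsicDist U x (γ t) * intrinsicDist U y (γ t) / intrinsicDist U x y ≤
        Metric.infDist (γ t) (frontier U)

open Filter Topology

section IntrinsicDist

variable {X : Type*} [MetricSpace X] {U : Set X}

/-- Any two points of `U` are joined by a rectifiable path in `U`. -/
def RectifiablyConnected (U : Set X) : Prop :=
  ∀ x ∈ U, ∀ y ∈ U, ∃ γ : ℝ → X, ContinuousOn γ (Set.Icc 0 1) ∧
      γ 0 = x ∧ γ 1 = y ∧ (∀ t ∈ Set.Icc (0 : ℝ) 1, γ t ∈ U) ∧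
      eVariationOn γ (Set.Icc 0 1) ≠ ⊤

lemma intrinsicDist_nonneg (x y : X) : 0 ≤ intrinsicDist U x y := by
  apply Real.sInf_nonneg
  rintro L ⟨γ, -, -, -, -, -, rfl⟩
  exact ENNReal.toReal_nonneg

/-- The intrinsic distance between the endpoints of a path parametrized by any compact interval
is at most the length of the path. -/
lemma intrinsicDist_le_eVariationOn {γ : ℝ → X} {a b : ℝ} (hab : a ≤ b)
    (hγ : ContinuousOn γ (Set.Icc a b)) (hU : ∀ t ∈ Set.Icc a b, γ t ∈ U)
    (hv : eVariationOn γ (Set.Icc a b) ≠ ⊤) :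
    intrinsicDist U (γ a) (γ b) ≤ (eVariationOn γ (Set.Icc a b)).toReal := by
  set φ : ℝ → ℝ := fun t ↦ a + t * (b - a) with hφ
  have hmono : Monotone φ := fun s t hst ↦ by
    have := mul_le_mul_of_nonneg_right hst (sub_nonneg.2 hab)
    simp only [hφ]
    linarith
  have h0 : φ 0 = a := by simp [hφ]
  have h1 : φ 1 = b := by simp [hφ]
  have hmaps : Set.MapsTo φ (Set.Icc 0 1) (Set.Icc a b) := fun t ht ↦
    ⟨h0 ▸ hmono ht.1, h1 ▸ hmono ht.2⟩
  have hle : eVariationOn (γ ∘ φ) (Set.Icc 0 1) ≤ eVariationOn γ (Set.Icc a b) :=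
    eVariationOn.comp_le_of_monotoneOn γ φ (hmono.monotoneOn _) hmaps
  have hfin : eVariationOn (γ ∘ φ) (Set.Icc 0 1) ≠ ⊤ := ne_top_of_le_ne_top hv hle
  refine le_trans ?_ (ENNReal.toReal_mono hv hle)
  unfold intrinsicDist
  refine csInf_le ⟨0, ?_⟩ ⟨γ ∘ φ, ?_, by simp [h0], by simp [h1], fun t ht ↦ hU _ (hmaps ht),
    hfin, rfl⟩
  · rintro L ⟨γ, -, -, -, -, -, rfl⟩
    exact ENNReal.toReal_nonneg
  · exact hγ.comp (by fun_prop) hmaps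

lemma RectifiablyConnected.exists_lt (hU : RectifiablyConnected U) {x y : X} (hx : x ∈ U)
    (hy : y ∈ U) {r : ℝ} (hr : intrinsicDist U x y < r) :
    ∃ γ : ℝ → X, ContinuousOn γ (Set.Icc 0 1) ∧ γ 0 = x ∧ γ 1 = y ∧
      (∀ t ∈ Set.Icc (0 : ℝ) 1, γ t ∈ U) ∧ eVariationOn γ (Set.Icc 0 1) ≠ ⊤ ∧
      (eVariationOn γ (Set.Icc 0 1)).toReal < r := by
  unfold intrinsicDist at hr
  obtain ⟨γ₀, h1, h2, h3, h4, h5⟩ := hU x hx y hy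
  obtain ⟨L, ⟨γ, hc, h0, h1, hm, hv, rfl⟩, hL⟩ :=
    exists_lt_of_csInf_lt (by exact ⟨_, γ₀, h1, h2, h3, h4, h5, rfl⟩) hr
  exact ⟨γ, hc, h0, h1, hm, hv, hL⟩

lemma RectifiablyConnected.dist_le_intrinsicDist (hU : RectifiablyConnected U) {x y : X}
    (hx : x ∈ U) (hy : y ∈ U) : dist x y ≤ intrinsicDist U x y := by
  refine le_of_forall_gt fun r hr ↦ ?_
  obtain ⟨γ, -, rfl, rfl, -, hv, hL⟩ := hU.exists_lt hx hy hr
  exact (BoundedVariationOn.dist_le hv (by simp) (by simp)).trans_lt hL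

lemma intrinsicDist_self {x : X} (hx : x ∈ U) : intrinsicDist U x x = 0 := by
  refine le_antisymm ?_ (intrinsicDist_nonneg x x)
  have h : eVariationOn (fun _ : ℝ ↦ x) (Set.Icc 0 0) = 0 :=
    eVariationOn.subsingleton _ (by simp)
  simpa [h] using intrinsicDist_le_eVariationOn (U := U) (γ := fun _ ↦ x) (le_refl (0 : ℝ))
    continuousOn_const (fun _ _ ↦ hx) (by simp)

lemma RectifiablyConnected.intrinsicDist_comm_le (hU : RectifiablyConnected U) {x y : X}
    (hx : x ∈ U) (hy : y ∈ U) : intrinsicDist U y x ≤ intrinsicDist U x y := by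
  refine le_of_forall_gt fun r hr ↦ ?_
  obtain ⟨γ, hc, rfl, rfl, hm, hv, hL⟩ := hU.exists_lt hx hy hr
  set φ : ℝ → ℝ := fun t ↦ 1 - t with hφ
  have hmaps : Set.MapsTo φ (Set.Icc 0 1) (Set.Icc 0 1) := fun t ht ↦ by
    simp only [hφ, Set.mem_Icc] at ht ⊢
    constructor <;> linarith
  have hanti : Antitone φ := fun s t hst ↦ by simp only [hφ]; linarith
  have hle : eVariationOn (γ ∘ φ) (Set.Icc 0 1) ≤ eVariationOn γ (Set.Icc 0 1) :=
    eVariationOn.comp_le_of_antitoneOn γ φ (hanti.antitoneOn _) hmaps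
  have := intrinsicDist_le_eVariationOn (U := U) (γ := γ ∘ φ) zero_le_one
    (hc.comp (by fun_prop) hmaps) (fun t ht ↦ hm _ (hmaps ht)) (ne_top_of_le_ne_top hv hle)
  simp only [hφ, Function.comp_apply, sub_zero, sub_self] at this
  exact (this.trans (ENNReal.toReal_mono hv hle)).trans_lt hL

lemma RectifiablyConnected.intrinsicDist_comm (hU : RectifiablyConnected U) {x y : X}
    (hx : x ∈ U) (hy : y ∈ U) : intrinsicDist U x y = intrinsicDist U y x :=
  le_antisymm (hU.intrinsicDist_comm_le hy hx) (hU.intrinsicDist_comm_le hx hy)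

lemma RectifiablyConnected.intrinsicDist_triangle (hU : RectifiablyConnected U) {x y z : X}
    (hx : x ∈ U) (hy : y ∈ U) (hz : z ∈ U) :
    intrinsicDist U x z ≤ intrinsicDist U x y + intrinsicDist U y z := by
  refine le_of_forall_pos_lt_add fun ε hε ↦ ?_
  obtain ⟨γ, hγc, rfl, rfl, hγU, hγv, hγL⟩ :=
    hU.exists_lt hx hy (lt_add_of_pos_right _ (half_pos hε))
  obtain ⟨δ, hδc, hδ0, rfl, hδU, hδv, hδL⟩ :=
    hU.exists_lt hy hz (lt_add_of_pos_right _ (half_pos hε))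
  set η : ℝ → X := fun t ↦ if t ≤ 1 then γ t else δ (t - 1) with hη
  have hη₁ : Set.EqOn η γ (Set.Icc 0 1) := fun t ht ↦ by simp [hη, ht.2]
  have hη₂ : Set.EqOn η (δ ∘ fun t ↦ t - 1) (Set.Icc 1 2) := fun t ht ↦ by
    rcases ht.1.eq_or_lt with rfl | h
    · simp [hη, hδ0]
    · simp [hη, h]
  have hmaps : Set.MapsTo (fun t : ℝ ↦ t - 1) (Set.Icc 1 2) (Set.Icc 0 1) := fun t ht ↦ by
    simp only [Set.mem_Icc] at ht ⊢
    constructor <;> linarith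
  have hunion : Set.Icc (0 : ℝ) 1 ∪ Set.Icc 1 2 = Set.Icc 0 2 :=
    Set.Icc_union_Icc_eq_Icc zero_le_one one_le_two
  have hc : ContinuousOn η (Set.Icc 0 2) := by
    rw [← hunion]
    exact (hγc.congr hη₁).union_of_isClosed ((hδc.comp (by fun_prop) hmaps).congr hη₂)
      isClosed_Icc isClosed_Icc
  have hηU : ∀ t ∈ Set.Icc (0 : ℝ) 2, η t ∈ U := by
    rw [← hunion]
    rintro t (ht | ht)
    · exact hη₁ ht ▸ hγU t ht
    · exact hη₂ ht ▸ hδU _ (hmaps ht)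
  have hle : eVariationOn η (Set.Icc 0 2) ≤
      eVariationOn γ (Set.Icc 0 1) + eVariationOn δ (Set.Icc 0 1) := by
    rw [← hunion, eVariationOn.union η (isGreatest_Icc zero_le_one) (isLeast_Icc one_le_two),
      eVariationOn.congr hη₁, eVariationOn.congr hη₂]
    gcongr
    exact eVariationOn.comp_le_of_monotoneOn δ _ (fun s _ t _ hst ↦ by simpa using hst) hmaps
  have hfin := ENNReal.add_ne_top.2 ⟨hγv, hδv⟩
  have key := (intrinsicDist_le_eVariationOn zero_le_two hc hηU
    (ne_top_of_le_ne_top hfin hle)).trans (ENNReal.toReal_mono hfin hle)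
  rw [ENNReal.toReal_add hγv hδv, hη₁ (by simp), hη₂ (by simp)] at key
  norm_num at key
  linarith

/-- Along a rectifiable path in `U`, the intrinsic distance to a fixed point is continuous. -/
lemma RectifiablyConnected.continuousOn_intrinsicDist (hU : RectifiablyConnected U) {x : X}
    (hx : x ∈ U) {γ : ℝ → X} {a b : ℝ} (hγ : ContinuousOn γ (Set.Icc a b))
    (hγU : ∀ t ∈ Set.Icc a b, γ t ∈ U) (hv : eVariationOn γ (Set.Icc a b) ≠ ⊤) :
    ContinuousOn (fun t ↦ intrinsicDist U x (γ t)) (Set.Icc a b) := by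
  intro t ht
  have hl := BoundedVariationOn.tendsto_eVariationOn_Icc_zero_left hv
    ((hγ t ht).mono Set.inter_subset_left)
  have hr := BoundedVariationOn.tendsto_eVariationOn_Icc_zero_right hv t
    ((hγ t ht).mono Set.inter_subset_left)
  have hsum := (ENNReal.tendsto_toReal ENNReal.zero_ne_top).comp hl |>.add
    ((ENNReal.tendsto_toReal ENNReal.zero_ne_top).comp hr)
  have hbound : ∀ p ∈ Set.Icc a b, ∀ q ∈ Set.Icc a b, p ≤ q →
      |intrinsicDist U x (γ q) - intrinsicDist U x (γ p)| ≤
        (eVariationOn γ (Set.Icc a b ∩ Set.Icc p q)).toReal := by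
    intro p hp q hq hpq
    have hsub : Set.Icc p q ⊆ Set.Icc a b := Set.Icc_subset_Icc hp.1 hq.2
    rw [Set.inter_eq_right.2 hsub]
    have h := intrinsicDist_le_eVariationOn hpq (hγ.mono hsub) (fun s hs ↦ hγU s (hsub hs))
      (ne_top_of_le_ne_top hv (eVariationOn.mono γ hsub))
    have h₁ := hU.intrinsicDist_triangle hx (hγU p hp) (hγU q hq)
    have h₂ := hU.intrinsicDist_triangle hx (hγU q hq) (hγU p hp)
    rw [hU.intrinsicDist_comm (hγU q hq) (hγU p hp)] at h₂
    rw [abs_le]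
    constructor <;> linarith
  rw [ContinuousWithinAt, tendsto_iff_dist_tendsto_zero]
  refine squeeze_zero' (Eventually.of_forall fun _ ↦ dist_nonneg) ?_ (by simpa using hsum)
  filter_upwards [self_mem_nhdsWithin] with s hs
  rw [Real.dist_eq]
  rcases le_total s t with h | h
  · rw [abs_sub_comm]
    exact (hbound s hs t ht h).trans (le_add_of_nonneg_right ENNReal.toReal_nonneg)
  · exact (hbound t ht s hs h).trans (le_add_of_nonneg_left ENNReal.toReal_nonneg)

/-- In a bounded inner uniform domain with nonempty boundary, intrinsic distances are controlled
by the diameter. -/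
lemma InnerUniform.intrinsicDist_le {C₀ c₀ : ℝ} (hiu : InnerUniform U C₀ c₀)
    (hU : RectifiablyConnected U) (hb : Bornology.IsBounded U) (hfr : (frontier U).Nonempty)
    (hc₀ : 0 < c₀) {x y : X} (hx : x ∈ U) (hy : y ∈ U) :
    intrinsicDist U x y ≤ 4 / c₀ * Metric.diam U := by
  rcases (intrinsicDist_nonneg (U := U) x y).eq_or_lt with h | hpos
  · rw [← h]
    have := Metric.diam_nonneg (s := U)
    positivity
  obtain ⟨γ, hγ, rfl, rfl, hγU, -, hv, hdist⟩ := hiu x hx y hy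
  set D := intrinsicDist U (γ 0) (γ 1) with hD
  have himage := intermediate_value_Icc zero_le_one (hU.continuousOn_intrinsicDist hx hγ hγU hv)
  obtain ⟨t, ht, hmid⟩ : D / 2 ∈ (fun t ↦ intrinsicDist U (γ 0) (γ t)) '' Set.Icc 0 1 := by
    apply himage
    simp only [intrinsicDist_self hx, Set.mem_Icc]
    constructor <;> linarith
  simp only at hmid
  have htri := hU.intrinsicDist_triangle hx (hγU t ht) hy
  rw [hU.intrinsicDist_comm (hγU t ht) hy, hmid, ← hD] at htri
  have hle := hdist t ht
  rw [hmid, div_le_iff₀ hpos] at hle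
  obtain ⟨p, hp⟩ := hfr
  have hdiam : Metric.infDist (γ t) (frontier U) ≤ Metric.diam U := by
    rw [← Metric.diam_closure]
    exact (Metric.infDist_le_dist_of_mem hp).trans (Metric.dist_le_diam_of_mem hb.closure
      (subset_closure (hγU t ht)) (frontier_subset_closure hp))
  have h₁ : c₀ * (D / 2) * (D / 2) ≤ Metric.diam U * D :=
    (mul_le_mul_of_nonneg_left (by linarith) (by positivity)).trans
      (hle.trans (mul_le_mul_of_nonneg_right hdiam hpos.le))
  have h₂ : c₀ * D / 4 ≤ Metric.diam U := le_of_mul_le_mul_right (by linarith) hpos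
  rw [div_mul_eq_mul_div, le_div_iff₀ hc₀]
  linarith

end IntrinsicDist


theorem stmt_7 {X : Type*} [MetricSpace X] (U : Set X) (hne : U.Nonempty)
    (hopen : IsOpen U) (hconn : IsConnected U) (hcpt : IsCompact (closure U))
    (hfr : (frontier U).Nonempty)
    (hrect : ∀ x ∈ U, ∀ y ∈ U, ∃ γ : ℝ → X, ContinuousOn γ (Set.Icc 0 1) ∧
      γ 0 = x ∧ γ 1 = y ∧ (∀ t ∈ Set.Icc (0 : ℝ) 1, γ t ∈ U) ∧
      eVariationOn γ (Set.Icc 0 1) ≠ ⊤)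
    (C₀ c₀ : ℝ) (hC₀ : 1 ≤ C₀) (hc₀ : 0 < c₀) (hc₀' : c₀ ≤ 1)
    (hiu : InnerUniform U C₀ c₀) :
    Metric.diam U ≤ intrinsicDiam U ∧ intrinsicDiam U ≤ (8 / c₀) * Metric.diam U := by
  have hU : RectifiablyConnected U := hrect
  have hb : Bornology.IsBounded U := hcpt.isBounded.subset subset_closure
  have hbound : ∀ x ∈ U, ∀ y ∈ U, intrinsicDist U x y ≤ 4 / c₀ * Metric.diam U :=
    fun x hx y hy ↦ hiu.intrinsicDist_le hU hb hfr hc₀ hx hy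
  have hnonneg : 0 ≤ intrinsicDiam U := by
    apply Real.sSup_nonneg
    rintro d ⟨x, -, y, -, rfl⟩
    exact intrinsicDist_nonneg x y
  constructor
  · refine Metric.diam_le_of_forall_dist_le hnonneg fun x hx y hy ↦ ?_
    refine (hU.dist_le_intrinsicDist hx hy).trans (le_csSup ⟨4 / c₀ * Metric.diam U, ?_⟩
      ⟨x, hx, y, hy, rfl⟩)
    rintro d ⟨x, hx, y, hy, rfl⟩
    exact hbound x hx y hy
  · obtain ⟨x₀, hx₀⟩ := hne
    refine csSup_le ⟨_, x₀, hx₀, x₀, hx₀, rfl⟩ ?_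
    rintro d ⟨x, hx, y, hy, rfl⟩
    refine (hbound x hx y hy).trans ?_
    have := Metric.diam_nonneg (s := U)
    gcongr
    norm_num
end
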